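/- Let B be an infinite-dimensional separable Banach space (over ℝ or ℂ). Then there exist a separable Hilbert space H₂ together with a continuous dense embedding i : B → H₂, and a separable Hilbert space H₁ together with a continuous dense embedding j : H₁ → B. -/

import Mathlib

/-- `B` embeds continuously and densely into a separable Hilbert space over `𝕜`. -/
structure EmbedsInSeparableHilbert (𝕜 : Type*) [RCLike 𝕜] (B : Type*)
    [NormedAddCommGroup B] [NormedSpace 𝕜 B] where
  H : Type
  [nag : NormedAddCommGroup H]
  [ips : InnerProductSpace 𝕜 H]
  [cs : CompleteSpace H]
  [sep : TopologicalSpace.SeparableSpace H]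
  i : B →L[𝕜] H
  inj : Function.Injective i
  dense : DenseRange i

/-- A separable Hilbert space over `𝕜` embeds continuously and densely into `B`. -/
structure SeparableHilbertEmbedsIn (𝕜 : Type*) [RCLike 𝕜] (B : Type*)
    [NormedAddCommGroup B] [NormedSpace 𝕜 B] where
  H : Type
  [nag : NormedAddCommGroup H]
  [ips : InnerProductSpace 𝕜 H]
  [cs : CompleteSpace H]
  [sep : TopologicalSpace.SeparableSpace H]
  j : H →L[𝕜] B
  inj : Function.Injective j
  dense : DenseRange j

theorem gk_shrink (𝕜 : Type*) [RCLike 𝕜] (H : Type*) [NormedAddCommGroup H]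
    [InnerProductSpace 𝕜 H] [CompleteSpace H] [TopologicalSpace.SeparableSpace H] :
    ∃ (T : Type) (_ : NormedAddCommGroup T) (_ : InnerProductSpace 𝕜 T) (_ : CompleteSpace T)
      (_ : TopologicalSpace.SeparableSpace T), Nonempty (T ≃L[𝕜] H) := by
  have hs : Small.{0} H := by
    refine small_of_injective (β := ℕ → ℝ)
      (f := fun x n => dist x (TopologicalSpace.denseSeq H n)) ?_
    intro x y hxy
    by_contra hne
    have hpos : 0 < dist x y / 2 := half_pos (dist_pos.2 hne)
    obtain ⟨n, hn⟩ := (TopologicalSpace.denseRange_denseSeq H).exists_dist_lt x hpos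
    have h1 := congrFun hxy n
    simp only at h1
    have h2 := dist_triangle_right x y (TopologicalSpace.denseSeq H n)
    linarith
  let e : Shrink.{0} H ≃ H := (equivShrink H).symm
  let i1 : NormedAddCommGroup (Shrink.{0} H) := e.normedAddCommGroup
  let i2 : NormedSpace 𝕜 (Shrink.{0} H) := e.normedSpace 𝕜
  let L : Shrink.{0} H ≃ₗ[𝕜] H := e.linearEquiv 𝕜
  have hL : ∀ x, ‖L x‖ = ‖x‖ := fun x => rfl
  let i3 : InnerProductSpace 𝕜 (Shrink.{0} H) :=
    { i2 with
      inner := fun x y => inner 𝕜 (L x) (L y)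
      norm_sq_eq_re_inner := fun x => by
        rw [← hL]; exact InnerProductSpace.norm_sq_eq_re_inner (L x)
      conj_inner_symm := fun x y => inner_conj_symm _ _
      add_left := fun x y z => by rw [map_add, inner_add_left]
      smul_left := fun x y r => by rw [map_smul, inner_smul_left] }
  let LI : Shrink.{0} H ≃ₗᵢ[𝕜] H := ⟨L, hL⟩
  have hc : CompleteSpace (Shrink.{0} H) :=
    (completeSpace_congr (e := LI.toEquiv) LI.isometry.isUniformEmbedding).2 inferInstance
  have hsep : TopologicalSpace.SeparableSpace (Shrink.{0} H) :=
    (LI.symm.surjective.denseRange).separableSpace LI.symm.continuous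
  exact ⟨Shrink.{0} H, i1, i3, hc, hsep, ⟨LI.toContinuousLinearEquiv⟩⟩

theorem gk_l2_sep (𝕜 : Type*) [RCLike 𝕜] :
    TopologicalSpace.SeparableSpace (lp (fun _ : ℕ => 𝕜) 2) := by
  let b : HilbertBasis ℕ 𝕜 (lp (fun _ : ℕ => 𝕜) 2) := default
  have h := b.dense_span
  have h2 : TopologicalSpace.IsSeparable
      (closure (Submodule.span 𝕜 (Set.range b) : Set (lp (fun _ : ℕ => 𝕜) 2))) :=
    ((Set.countable_range b).isSeparable.span (R := 𝕜)).closure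
  rw [← Submodule.topologicalClosure_coe, h] at h2
  exact TopologicalSpace.isSeparable_univ_iff.1 h2

theorem gk_tsum {𝕜 : Type*} [RCLike 𝕜] {X Y : Type*} [NormedAddCommGroup X] [NormedSpace 𝕜 X]
    [NormedAddCommGroup Y] [NormedSpace 𝕜 Y] [CompleteSpace Y] (f : ℕ → X →L[𝕜] 𝕜) (y : ℕ → Y) :
    ∃ (c : ℕ → 𝕜) (T : X →L[𝕜] Y), (∀ n, c n ≠ 0) ∧
      ∀ x, HasSum (fun n => (c n * f n x) • y n) (T x) := by
  let r : ℕ → ℝ := fun n => (1 / 2) ^ n * (1 + ‖f n‖ * ‖y n‖)⁻¹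
  have hp : ∀ n, 0 < 1 + ‖f n‖ * ‖y n‖ := fun n => by positivity
  have hr : ∀ n, 0 < r n := fun n => by have := hp n; positivity
  let g : ℕ → X →L[𝕜] Y := fun n => (r n : 𝕜) • (f n).smulRight (y n)
  have hg : Summable g := by
    refine Summable.of_norm_bounded summable_geometric_two (fun n => ?_)
    have h1 : ‖g n‖ = r n * (‖f n‖ * ‖y n‖) := by
      simp only [g]
      rw [norm_smul, ContinuousLinearMap.norm_smulRight_apply, RCLike.norm_ofReal,
        abs_of_pos (hr n)]
    rw [h1]
    simp only [r]
    rw [mul_assoc]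
    refine mul_le_of_le_one_right (by positivity) ?_
    rw [inv_mul_le_iff₀ (hp n)]
    linarith
  refine ⟨fun n => (r n : 𝕜), ∑' n, g n, fun n => ?_, fun x => ?_⟩
  · exact RCLike.ofReal_ne_zero.2 (hr n).ne'
  · have h := hg.hasSum.mapL (ContinuousLinearMap.apply 𝕜 Y x)
    simpa [g, mul_smul] using h

theorem gk_into {𝕜 : Type*} [RCLike 𝕜] {B : Type*}
    [NormedAddCommGroup B] [NormedSpace 𝕜 B] [TopologicalSpace.SeparableSpace B] :
    Nonempty (EmbedsInSeparableHilbert 𝕜 B) := by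
  let E := lp (fun _ : ℕ => 𝕜) 2
  let b : HilbertBasis ℕ 𝕜 E := default
  let x := TopologicalSpace.denseSeq B
  choose f hf1 hf2 using fun n => exists_dual_vector'' 𝕜 (x n)
  obtain ⟨c, T, hc, hT⟩ := gk_tsum f b
  have hco : ∀ v n, inner 𝕜 (b n) (T v) = c n * f n v := by
    intro v n
    have h := (hT v).mapL (innerSL 𝕜 (b n))
    have h2 := hasSum_single (f := fun m => innerSL 𝕜 (b n) ((c m * f m v) • b m)) n (by
      intro m hm
      simp [inner_smul_right, b.orthonormal.2 hm.symm])
    have h3 := h.unique h2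
    simpa [inner_smul_right, b.orthonormal.1 n] using h3
  have hinj : Function.Injective T := by
    rw [injective_iff_map_eq_zero]
    intro v hv
    have hz : ∀ n, f n v = 0 := fun n => by
      have h := hco v n
      rw [hv, inner_zero_right] at h
      exact (mul_eq_zero.1 h.symm).resolve_left (hc n)
    by_contra hne
    have hpos : 0 < ‖v‖ / 2 := half_pos (norm_pos_iff.2 hne)
    obtain ⟨n, hn⟩ := (TopologicalSpace.denseRange_denseSeq B).exists_dist_lt v hpos
    rw [dist_eq_norm] at hn
    have h1 : ‖x n‖ ≤ ‖v - x n‖ := by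
      have h2 := (f n).le_of_opNorm_le (hf1 n) (v - x n)
      rw [map_sub, hz, hf2, zero_sub, norm_neg, RCLike.norm_ofReal, abs_norm, one_mul] at h2
      exact h2
    have h3 := norm_sub_norm_le v (x n)
    have h4 : ‖v - x n‖ < ‖v‖ / 2 := hn
    linarith
  let K : Submodule 𝕜 E := T.range.topologicalClosure
  have hK : ∀ v, T v ∈ K := fun v => T.range.le_topologicalClosure ⟨v, rfl⟩
  have : CompleteSpace K := T.range.isClosed_topologicalClosure.completeSpace_coe
  let T' : B →L[𝕜] K := T.codRestrict K hK
  have hd : DenseRange T' := by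
    intro k
    rw [closure_subtype]
    have hk : (k : E) ∈ closure (Set.range T) := k.2
    have him : ((↑) '' Set.range T' : Set E) = Set.range T := by
      rw [← Set.range_comp]; rfl
    rw [him]
    exact hk
  have : TopologicalSpace.SeparableSpace K := hd.separableSpace T'.continuous
  obtain ⟨H, _, _, _, _, ⟨e⟩⟩ := gk_shrink 𝕜 K
  refine ⟨⟨H, (e.symm : K →L[𝕜] H).comp T', ?_, ?_⟩⟩
  · refine e.symm.injective.comp ?_
    intro u v huv
    exact hinj (congrArg Subtype.val huv)
  · exact e.symm.surjective.denseRange.comp hd e.symm.continuous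

theorem gk_from {𝕜 : Type*} [RCLike 𝕜] {B : Type*}
    [NormedAddCommGroup B] [NormedSpace 𝕜 B] [CompleteSpace B]
    [TopologicalSpace.SeparableSpace B] :
    Nonempty (SeparableHilbertEmbedsIn 𝕜 B) := by
  let E := lp (fun _ : ℕ => 𝕜) 2
  have : TopologicalSpace.SeparableSpace E := gk_l2_sep 𝕜
  let b : HilbertBasis ℕ 𝕜 E := default
  let x := TopologicalSpace.denseSeq B
  obtain ⟨c, T, hc, hT⟩ := gk_tsum (fun n => innerSL 𝕜 (b n)) x
  have hb : ∀ n, T (b n) = c n • x n := by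
    intro n
    have h := hT (b n)
    have h2 := hasSum_single (f := fun m => (c m * innerSL 𝕜 (b m) (b n)) • x m) n (by
      intro m hm
      simp [b.orthonormal.2 hm])
    have h3 := h.unique h2
    simpa [b.orthonormal.1 n] using h3
  let K : Submodule 𝕜 E := T.ker
  have : CompleteSpace K := T.isClosed_ker.completeSpace_coe
  let J : Kᗮ →L[𝕜] B := T.comp Kᗮ.subtypeL
  have hJi : Function.Injective J := by
    rw [injective_iff_map_eq_zero]
    intro v hv
    have h1 : (v : E) ∈ K := hv
    have h2 := K.inner_right_of_mem_orthogonal h1 v.2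
    exact Subtype.ext (inner_self_eq_zero.1 h2)
  have hJd : DenseRange J := by
    refine (TopologicalSpace.denseRange_denseSeq B).mono ?_
    rintro _ ⟨n, rfl⟩
    let w : E := (c n)⁻¹ • b n
    refine ⟨⟨w - K.starProjection w, K.sub_starProjection_mem_orthogonal w⟩, ?_⟩
    have h1 : T (K.starProjection w) = 0 := K.starProjection_apply_mem w
    change T (w - K.starProjection w) = x n
    rw [map_sub, h1, sub_zero]
    simp only [w]
    rw [map_smul, hb, smul_smul, inv_mul_cancel₀ (hc n), one_smul]
  obtain ⟨H, _, _, _, _, ⟨e⟩⟩ := gk_shrink 𝕜 Kᗮ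
  exact ⟨⟨H, J.comp (e : H →L[𝕜] Kᗮ), hJi.comp e.injective,
    hJd.comp e.surjective.denseRange J.continuous⟩⟩

/-- (Gross–Kuelbs, embedding part.) Every infinite-dimensional separable Banach space `B`
over `ℝ` or `ℂ` admits a continuous dense embedding into a separable Hilbert space `H₂`,
and a separable Hilbert space `H₁` admits a continuous dense embedding into `B`. -/
theorem gross_kuelbs_embeddings (𝕜 : Type*) [RCLike 𝕜] (B : Type*)
    [NormedAddCommGroup B] [NormedSpace 𝕜 B] [CompleteSpace B]
    [TopologicalSpace.SeparableSpace B] (hinf : ¬ FiniteDimensional 𝕜 B) :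
    Nonempty (EmbedsInSeparableHilbert 𝕜 B) ∧ Nonempty (SeparableHilbertEmbedsIn 𝕜 B) :=
  ⟨gk_into, gk_from⟩
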